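/- Let n ≥ 1, T > 0, c > 0, and let D be a real diagonal n×n matrix. Then the reachable set from cI under isospectral control with spectrum D in time T equals exactly R(cI, D, T) = { Σ_T ∈ S⁺⁺ⁿ : log λ(Σ_T) ≺ (log c)·𝟙 + 2T·λ(D) }, where 𝟙 is the all-ones vector; that is, Σ_T ∈ S⁺⁺ⁿ is reachable from cI if and only if the vector of logarithms of the eigenvalues of Σ_T is majorized by the vector with entries log c + 2T·λᵢ(D). -/

import Mathlib

open MeasureTheory Matrix

/-- The entries of `v` sorted in decreasing order. -/
noncomputable def sortDesc {n : ℕ} (v : Fin n → ℝ) : Fin n → ℝ :=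
  fun i => v (Tuple.sort v i.rev)

/-- `x` is majorized by `y`. -/
def IsMajorizedBy {n : ℕ} (x y : Fin n → ℝ) : Prop :=
  (∑ i, x i = ∑ i, y i) ∧
  ∀ k : ℕ, k < n →
    ∑ i ∈ Finset.univ.filter (fun i : Fin n => (i : ℕ) < k), sortDesc x i ≤
    ∑ i ∈ Finset.univ.filter (fun i : Fin n => (i : ℕ) < k), sortDesc y i

/-- `ΣT` is reachable from `Σ₀` under isospectral control with spectrum `D` in time `T`. -/
noncomputable def IsReachable {n : ℕ} (P₀ PT D : Matrix (Fin n) (Fin n) ℝ) (T : ℝ) : Prop :=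
  ∃ U S : ℝ → Matrix (Fin n) (Fin n) ℝ,
    (∀ i j, Measurable fun t => U t i j) ∧
    (∀ t ∈ Set.Icc (0:ℝ) T, U t * (U t)ᵀ = 1) ∧
    (∀ t ∈ Set.Icc (0:ℝ) T, (S t).PosDef) ∧
    S 0 = P₀ ∧ S T = PT ∧
    (∀ i j, IntervalIntegrable
        (fun t => ((U t * D * (U t)ᵀ) * S t + S t * (U t * D * (U t)ᵀ)) i j)
        MeasureTheory.volume 0 T) ∧
    (∀ t ∈ Set.Icc (0:ℝ) T, ∀ i j,
      S t i j = P₀ i j +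
        ∫ s in (0:ℝ)..t, ((U s * D * (U s)ᵀ) * S s + S s * (U s * D * (U s)ᵀ)) i j)

/-- The permutation that lists the entries of `v` in decreasing order. -/
noncomputable def sortDescPerm {n : ℕ} (v : Fin n → ℝ) : Equiv.Perm (Fin n) :=
  Fin.revPerm.trans (Tuple.sort v)

lemma sortDesc_apply {n : ℕ} (v : Fin n → ℝ) (i : Fin n) :
    sortDesc v i = v (sortDescPerm v i) := rfl

lemma antitone_sortDesc {n : ℕ} (v : Fin n → ℝ) : Antitone (sortDesc v) :=
  fun _ _ h => Tuple.monotone_sort v (Fin.rev_le_rev.mpr h)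

lemma sum_sortDesc {n : ℕ} (v : Fin n → ℝ) : ∑ i, sortDesc v i = ∑ i, v i :=
  Equiv.sum_comp (sortDescPerm v) v

lemma Antitone.mul_sum_le_sum_mul {m : ℕ} (w z : Fin (m + 1) → ℝ) (hw : Antitone w)
    (hz : ∀ k ≤ m + 1, 0 ≤ ∑ i ∈ Finset.univ.filter (fun i : Fin (m + 1) => (i : ℕ) < k), z i) :
    w (Fin.last m) * ∑ i, z i ≤ ∑ i, w i * z i := by
  induction m with
  | zero => simp
  | succ m ih =>
    have key : ∀ k ≤ m + 1,
        ∑ i ∈ Finset.univ.filter (fun i : Fin (m + 1) => (i : ℕ) < k), z i.castSucc =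
        ∑ i ∈ Finset.univ.filter (fun i : Fin (m + 2) => (i : ℕ) < k), z i := by
      intro k hk
      rw [Finset.sum_filter, Finset.sum_filter]
      rw [Fin.sum_univ_castSucc (n := m + 1)]
      simp [hk.not_gt]
    have h := ih (fun i => w i.castSucc) (fun i => z i.castSucc)
      (fun i j hij => hw (by simpa using hij))
      (fun k hk => by rw [key k hk]; exact hz k (by omega))
    have hpos : 0 ≤ ∑ i : Fin (m + 1), z i.castSucc := by
      have h1 := hz (m + 1) (by omega)
      rw [← key (m + 1) le_rfl] at h1
      rwa [Finset.filter_true_of_mem (fun i _ => i.2)] at h1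
    have hlast : w (Fin.last (m + 1)) ≤ w (Fin.last m).castSucc := hw (Fin.le_last _)
    rw [Fin.sum_univ_castSucc, Fin.sum_univ_castSucc (f := fun i => w i * z i)]
    nlinarith [mul_le_mul_of_nonneg_right hlast hpos]

lemma Antitone.sum_mul_sortDesc_le {n : ℕ} {w : Fin n → ℝ} (hw : Antitone w) {x y : Fin n → ℝ}
    (h : IsMajorizedBy x y) :
    ∑ i, w i * sortDesc x i ≤ ∑ i, w i * sortDesc y i := by
  rcases n with _ | m
  · simp
  have hsum : ∑ i, (sortDesc y i - sortDesc x i) = 0 := by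
    rw [Finset.sum_sub_distrib, sum_sortDesc, sum_sortDesc, h.1, sub_self]
  have := Antitone.mul_sum_le_sum_mul w (fun i => sortDesc y i - sortDesc x i) hw (by
    intro k hk
    rcases hk.lt_or_eq with hk | rfl
    · rw [Finset.sum_sub_distrib]
      exact sub_nonneg.mpr (h.2 k hk)
    · rw [Finset.filter_true_of_mem (fun i _ => i.2), hsum])
  rw [hsum, mul_zero] at this
  simpa [mul_sub] using this

lemma sum_mul_le_sum_sortDesc_mul_sortDesc {n : ℕ} (x w : Fin n → ℝ) :
    ∑ i, x i * w i ≤ ∑ i, sortDesc w i * sortDesc x i := by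
  have hm : Monovary (sortDesc x) (sortDesc w) :=
    (antitone_sortDesc x).monovary (antitone_sortDesc w)
  have h := hm.sum_comp_perm_mul_le_sum_mul (σ := (sortDescPerm w).trans (sortDescPerm x).symm)
  rw [← Equiv.sum_comp (sortDescPerm w) (fun i => x i * w i)]
  calc _ ≤ ∑ i, sortDesc x i * sortDesc w i := by
        simpa [sortDesc_apply] using h
    _ = _ := Finset.sum_congr rfl fun i _ => mul_comm _ _

/-- Rado's theorem: a vector majorized by `y` is a convex combination of rearrangements of `y`. -/
theorem IsMajorizedBy.mem_convexHull {n : ℕ} {x y : Fin n → ℝ} (h : IsMajorizedBy x y) :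
    x ∈ convexHull ℝ (Set.range fun σ : Equiv.Perm (Fin n) => y ∘ σ) := by
  by_contra hx
  obtain ⟨f, u, hf, hu⟩ := geometric_hahn_banach_closed_point (convex_convexHull ℝ _)
    ((Set.finite_range fun σ : Equiv.Perm (Fin n) => y ∘ σ).isClosed_convexHull (𝕜 := ℝ)) hx
  set w : Fin n → ℝ := fun i => f (Pi.single i 1) with hw
  have hfw : ∀ a, f a = ∑ i, a i * w i := by
    intro a
    conv_lhs => rw [pi_eq_sum_univ' a]
    simp [hw]
  have h1 : f x ≤ ∑ i, sortDesc w i * sortDesc y i := by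
    rw [hfw]
    exact (sum_mul_le_sum_sortDesc_mul_sortDesc x w).trans
      ((antitone_sortDesc w).sum_mul_sortDesc_le h)
  have h2 := hf _ (subset_convexHull ℝ _ ⟨(sortDescPerm w).symm.trans (sortDescPerm y), rfl⟩)
  rw [hfw, ← Equiv.sum_comp (sortDescPerm w)] at h2
  refine lt_irrefl u (hu.trans (h1.trans_lt (lt_of_eq_of_lt ?_ h2)))
  exact Finset.sum_congr rfl fun i _ => by simp [sortDesc_apply, mul_comm]

lemma Measurable.intervalIntegrable_of_abs_le {h : ℝ → ℝ} (hm : Measurable h) {C : ℝ}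
    (hC : ∀ t, |h t| ≤ C) (a b : ℝ) : IntervalIntegrable h volume a b :=
  (intervalIntegrable_const (c := C)).mono_fun hm.aestronglyMeasurable
    (Filter.Eventually.of_forall fun t => by
      simpa using (hC t).trans (le_abs_self C))

lemma exists_measurable_schedule {ι : Type*} [Fintype ι] [Nonempty ι] (p : ι → ℝ)
    (hp : ∀ i, 0 ≤ p i) (s : Finset ι) :
    ∃ f : ℝ → ι, ∀ g : ι → ℝ, Measurable (fun t => g (f t)) ∧
      ∫ t in (0 : ℝ)..∑ i ∈ s, p i, g (f t) = ∑ i ∈ s, p i * g i := by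
  classical
  have hint : ∀ (f : ℝ → ι) (g : ι → ℝ), Measurable (fun t => g (f t)) → ∀ a b : ℝ,
      IntervalIntegrable (fun t => g (f t)) volume a b := fun f g hm a b =>
    hm.intervalIntegrable_of_abs_le (C := ∑ i, |g i|)
      (fun t => Finset.single_le_sum (f := fun i => |g i|) (fun i _ => abs_nonneg _)
        (Finset.mem_univ (f t))) a b
  induction s using Finset.induction_on with
  | empty => exact ⟨fun _ => Classical.arbitrary ι, fun g => ⟨measurable_const, by simp⟩⟩
  | insert a s ha ih =>
    obtain ⟨f, hf⟩ := ih
    set Q := ∑ i ∈ s, p i with hQ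
    have hQ0 : 0 ≤ Q := Finset.sum_nonneg fun i _ => hp i
    have hmeas : ∀ g : ι → ℝ, Measurable (fun t => g (if t ≤ Q then f t else a)) := fun g => by
      simp only [apply_ite g]
      exact Measurable.ite measurableSet_Iic (hf g).1 measurable_const
    refine ⟨fun t => if t ≤ Q then f t else a, fun g => ⟨hmeas g, ?_⟩⟩
    rw [Finset.sum_insert ha, Finset.sum_insert ha, ← hQ, add_comm (p a),
      ← intervalIntegral.integral_add_adjacent_intervals (b := Q) (hint _ g (hmeas g) _ _)
        (hint _ g (hmeas g) _ _), add_comm (p a * g a)]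
    congr 1
    · rw [← (hf g).2]
      refine intervalIntegral.integral_congr fun t ht => ?_
      rw [Set.uIcc_of_le hQ0] at ht
      simp [ht.2]
    · calc ∫ t in Q..Q + p a, g (if t ≤ Q then f t else a) = ∫ _t in Q..Q + p a, g a := by
            refine intervalIntegral.integral_congr_ae (Filter.Eventually.of_forall fun t ht => ?_)
            rw [Set.uIoc_of_le (by linarith [hp a])] at ht
            simp [ht.1.not_ge]
        _ = p a * g a := by simp

lemma exp_integral_eq {h : ℝ → ℝ} (hm : Measurable h) {C : ℝ} (hC : ∀ t, |h t| ≤ C) (t : ℝ) :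
    Real.exp (∫ s in (0 : ℝ)..t, h s) =
      1 + ∫ s in (0 : ℝ)..t, h s * Real.exp (∫ r in (0 : ℝ)..s, h r) := by
  set H : ℝ → ℝ := fun s => ∫ r in (0 : ℝ)..s, h r with hH
  have hint := hm.intervalIntegrable_of_abs_le hC
  have hC0 : 0 ≤ C := (abs_nonneg _).trans (hC 0)
  have hlip : LipschitzWith C.toNNReal H := by
    refine LipschitzWith.of_dist_le_mul fun x y => ?_
    rw [Real.dist_eq, Real.dist_eq, Real.coe_toNNReal C hC0, hH]
    simp only
    rw [intervalIntegral.integral_interval_sub_left (hint _ _) (hint _ _)]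
    exact intervalIntegral.norm_integral_le_of_norm_le_const (f := h) fun s _ => hC s
  have hcomp : IsCompact (H '' Set.uIcc 0 t) := isCompact_uIcc.image hlip.continuous
  obtain ⟨K, hK⟩ := (Real.contDiff_exp (n := 1)).locallyLipschitz.locallyLipschitzOn
    |>.exists_lipschitzOnWith_of_compact hcomp
  have hac : AbsolutelyContinuousOnInterval (fun s => Real.exp (H s)) 0 t :=
    (hK.comp hlip.lipschitzOnWith (Set.mapsTo_image _ _)).absolutelyContinuousOnInterval
  have hloc : LocallyIntegrable h volume := by
    refine (locallyIntegrable_const C).mono hm.aestronglyMeasurable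
      (Filter.Eventually.of_forall fun s => ?_)
    simpa using (hC s).trans (le_abs_self C)
  have hd := hac.integral_deriv_eq_sub
  have hcongr : ∫ s in (0 : ℝ)..t, deriv (fun s => Real.exp (H s)) s =
      ∫ s in (0 : ℝ)..t, h s * Real.exp (H s) := by
    refine intervalIntegral.integral_congr_ae ?_
    filter_upwards [LocallyIntegrable.ae_hasDerivAt_integral hloc] with s hs _
    rw [(hs 0).exp.deriv, mul_comm]
  rw [hcongr] at hd
  have h0 : H 0 = 0 := by simp [hH]
  rw [hd, h0, Real.exp_zero]
  ring

lemma mul_diagonal_mul_transpose_apply {m n : ℕ} (V : Matrix (Fin m) (Fin n) ℝ) (d : Fin n → ℝ)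
    (i j : Fin m) : (V * diagonal d * Vᵀ) i j = ∑ k, V i k * d k * V j k := by
  rw [Matrix.mul_apply]
  simp [Matrix.mul_diagonal]

lemma exists_orthogonal_diagonalization {n : ℕ} {P : Matrix (Fin n) (Fin n) ℝ}
    (hP : P.IsHermitian) :
    ∃ V : Matrix (Fin n) (Fin n) ℝ, V * Vᵀ = 1 ∧ Vᵀ * V = 1 ∧
      P = V * diagonal hP.eigenvalues * Vᵀ := by
  refine ⟨hP.eigenvectorUnitary, ?_, ?_, ?_⟩
  · exact Unitary.coe_mul_star_self hP.eigenvectorUnitary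
  · exact Unitary.coe_star_mul_self hP.eigenvectorUnitary
  · conv_lhs => rw [hP.spectral_theorem, Unitary.conjStarAlgAut_apply]
    rfl

/-- A vector of logarithmic eigenvalues in the convex hull of the rearrangements of
`log c + 2 T λ(D)` is reached by running through the rearrangements of `D` in a fixed eigenbasis. -/
theorem isReachable_of_mem_convexHull {n : ℕ} {T c : ℝ} (hT : 0 < T) (hc : 0 < c)
    {D : Matrix (Fin n) (Fin n) ℝ} (hD : D.IsDiag) {PT : Matrix (Fin n) (Fin n) ℝ}
    (hPT : PT.PosDef)
    (h : (fun i => Real.log (hPT.1.eigenvalues i)) ∈ convexHull ℝ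
      (Set.range fun σ : Equiv.Perm (Fin n) => (fun i => Real.log c + 2 * T * D i i) ∘ σ)) :
    IsReachable (c • (1 : Matrix (Fin n) (Fin n) ℝ)) PT D T := by
  obtain ⟨ι, _, w, z, hw0, hw1, hz, hx⟩ := mem_convexHull_iff_exists_fintype.mp h
  choose σ hσ using hz
  obtain ⟨V, hV, hV', hPV⟩ := exists_orthogonal_diagonalization hPT.1
  have : Nonempty ι := by
    by_contra hne
    rw [not_nonempty_iff] at hne
    simp at hw1
  obtain ⟨f, hf⟩ := exists_measurable_schedule (fun i => T * w i)
    (fun i => mul_nonneg hT.le (hw0 i)) Finset.univ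
  rw [← Finset.mul_sum, hw1, mul_one] at hf
  set d : Fin n → ℝ → ℝ := fun k t => 2 * D (σ (f t) k) (σ (f t) k) with hd
  have hdm : ∀ k, Measurable (d k) := fun k => (hf fun i => 2 * D (σ i k) (σ i k)).1
  set C : ℝ := ∑ k, |2 * D k k| with hC
  have hdC : ∀ k t, |d k t| ≤ C := fun k t =>
    Finset.single_le_sum (f := fun k => |2 * D k k|) (fun i _ => abs_nonneg _)
      (Finset.mem_univ (σ (f t) k))
  set s : Fin n → ℝ → ℝ := fun k t => c * Real.exp (∫ r in (0 : ℝ)..t, d k r) with hs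
  have hspos : ∀ k t, 0 < s k t := fun k t => mul_pos hc (Real.exp_pos _)
  have hint : ∀ k a b, IntervalIntegrable (fun t => d k t * s k t) volume a b := by
    intro k a b
    refine ((hdm k).intervalIntegrable_of_abs_le (hdC k) a b).mul_continuousOn ?_
    exact (continuous_const.mul (Real.continuous_exp.comp
      (intervalIntegral.continuous_primitive
        ((hdm k).intervalIntegrable_of_abs_le (hdC k)) 0))).continuousOn
  have hsint : ∀ k t, s k t = c + ∫ r in (0 : ℝ)..t, d k r * s k r := by
    intro k t
    have h1 : ∀ r, d k r * s k r = c * (d k r * Real.exp (∫ u in (0 : ℝ)..r, d k u)) :=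
      fun r => by simp only [hs]; ring
    simp only [h1]
    rw [intervalIntegral.integral_const_mul]
    simp only [hs]
    rw [exp_integral_eq (hdm k) (hdC k) t]
    ring
  have hsT : ∀ k, s k T = hPT.1.eigenvalues k := by
    intro k
    have h1 : ∫ r in (0 : ℝ)..T, d k r = ∑ i, T * w i * (2 * D (σ i k) (σ i k)) :=
      (hf fun i => 2 * D (σ i k) (σ i k)).2
    have h2 := congrFun hx k
    simp only [Finset.sum_apply, Pi.smul_apply, smul_eq_mul, ← hσ, Function.comp_apply, mul_add,
      Finset.sum_add_distrib] at h2
    rw [← Finset.sum_mul, hw1, one_mul] at h2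
    have h3 : ∫ r in (0 : ℝ)..T, d k r = Real.log (hPT.1.eigenvalues k) - Real.log c := by
      rw [h1, ← h2, add_sub_cancel_left]
      exact Finset.sum_congr rfl fun i _ => by ring
    simp only [hs]
    rw [h3, Real.exp_sub, Real.exp_log (hPT.eigenvalues_pos k), Real.exp_log hc]
    field_simp
  set U : ℝ → Matrix (Fin n) (Fin n) ℝ := fun t => V.submatrix id (σ (f t)).symm with hU
  have hUD : ∀ t, U t * D * (U t)ᵀ = V * diagonal (fun k => D (σ (f t) k) (σ (f t) k)) * Vᵀ := by
    intro t
    ext i j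
    rw [mul_diagonal_mul_transpose_apply, ← hD.diagonal_diag, mul_diagonal_mul_transpose_apply,
      ← Equiv.sum_comp (σ (f t))]
    simp [hU]
  set S : ℝ → Matrix (Fin n) (Fin n) ℝ := fun t => V * diagonal (fun k => s k t) * Vᵀ with hS
  have hcancel : ∀ a b : Fin n → ℝ, (V * diagonal a * Vᵀ) * (V * diagonal b * Vᵀ) =
      V * diagonal (fun k => a k * b k) * Vᵀ := by
    intro a b
    calc _ = V * diagonal a * (Vᵀ * V) * diagonal b * Vᵀ := by simp only [Matrix.mul_assoc]
      _ = _ := by rw [hV', Matrix.mul_one, Matrix.mul_assoc V, Matrix.diagonal_mul_diagonal]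
  have hrhs : ∀ t, (U t * D * (U t)ᵀ) * S t + S t * (U t * D * (U t)ᵀ) =
      V * diagonal (fun k => d k t * s k t) * Vᵀ := by
    intro t
    rw [hUD, hS]
    simp only
    rw [hcancel, hcancel, ← Matrix.add_mul, ← Matrix.mul_add, Matrix.diagonal_add]
    congr 3
    ext k
    simp only [hd]
    ring
  have hterm : ∀ (i j k : Fin n) (a b : ℝ),
      IntervalIntegrable (fun t => V i k * (d k t * s k t) * V j k) volume a b :=
    fun i j k a b => ((hint k a b).const_mul _).mul_const _
  refine ⟨U, S, ?_, ?_, ?_, ?_, ?_, ?_, ?_⟩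
  · exact fun i j => (hf fun a => V i ((σ a).symm j)).1
  · intro t _
    rw [hU]
    simp only
    rw [Matrix.transpose_submatrix, Matrix.submatrix_mul_equiv, hV, Matrix.submatrix_id_id]
  · intro t _
    have h1 : (diagonal fun k => s k t).PosDef := Matrix.PosDef.diagonal fun k => hspos k t
    exact h1.mul_mul_conjTranspose_same (Matrix.vecMul_injective_of_isUnit
      (IsUnit.of_mul_eq_one _ hV))
  · simp only [hS, hs]
    simp only [intervalIntegral.integral_same, Real.exp_zero, mul_one]
    rw [← Matrix.smul_one_eq_diagonal, Matrix.mul_smul, Matrix.smul_mul, Matrix.mul_one, hV]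
  · simp only [hS, hsT]
    exact hPV.symm
  · intro i j
    simp only [hrhs, mul_diagonal_mul_transpose_apply]
    simpa only [Finset.sum_fn] using IntervalIntegrable.sum Finset.univ fun k _ => hterm i j k 0 T
  · intro t _ i j
    simp only [hrhs, mul_diagonal_mul_transpose_apply]
    rw [intervalIntegral.integral_finsetSum fun k _ => hterm i j k 0 t]
    simp only [intervalIntegral.integral_mul_const, intervalIntegral.integral_const_mul]
    have h0 : (c • (1 : Matrix (Fin n) (Fin n) ℝ)) i j = ∑ k, V i k * c * V j k := by
      rw [← mul_diagonal_mul_transpose_apply, ← Matrix.smul_one_eq_diagonal, Matrix.mul_smul,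
        Matrix.smul_mul, Matrix.mul_one, hV]
    rw [h0, ← Finset.sum_add_distrib, hS]
    simp only [mul_diagonal_mul_transpose_apply]
    refine Finset.sum_congr rfl fun k _ => ?_
    rw [hsint k t]
    ring

lemma Matrix.PosSemidef.det_le_exp_trace_sub {k : ℕ} {G : Matrix (Fin k) (Fin k) ℝ}
    (hG : G.PosSemidef) : G.det ≤ Real.exp (G.trace - k) := by
  rw [hG.1.det_eq_prod_eigenvalues, hG.1.trace_eq_sum_eigenvalues]
  have h : ∏ i, hG.1.eigenvalues i ≤ ∏ i, Real.exp (hG.1.eigenvalues i - 1) :=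
    Finset.prod_le_prod (fun i _ => hG.eigenvalues_nonneg i) fun i _ => by
      linarith [Real.add_one_le_exp (hG.1.eigenvalues i - 1)]
  rw [← Real.exp_sum, Finset.sum_sub_distrib] at h
  simpa using h

open scoped MatrixOrder in
lemma Matrix.PosDef.exists_congr_one {k : ℕ} {G : Matrix (Fin k) (Fin k) ℝ} (hG : G.PosDef) :
    ∃ K : Matrix (Fin k) (Fin k) ℝ, Kᵀ * G * K = 1 ∧
      ∀ F : Matrix (Fin k) (Fin k) ℝ, F.det = G.det * (Kᵀ * F * K).det := by
  obtain ⟨R, hR⟩ := CStarAlgebra.nonneg_iff_eq_star_mul_self.mp hG.posSemidef.nonneg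
  have hR' : G = Rᵀ * R := hR
  have hdet : G.det = R.det * R.det := by rw [hR', det_mul, det_transpose]
  have hu : IsUnit R.det := by
    refine isUnit_iff_ne_zero.mpr fun h0 => hG.det_pos.ne' ?_
    rw [hdet, h0, zero_mul]
  have hone : (R⁻¹)ᵀ * G * R⁻¹ = 1 := by
    calc (R⁻¹)ᵀ * G * R⁻¹ = (R * R⁻¹)ᵀ * (R * R⁻¹) := by
          rw [hR', Matrix.transpose_mul]; simp only [Matrix.mul_assoc]
      _ = 1 := by rw [Matrix.mul_nonsing_inv _ hu]; simp
  refine ⟨R⁻¹, hone, fun F => ?_⟩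
  have h1 := congrArg Matrix.det hone
  simp only [det_mul, det_transpose, det_one] at h1 ⊢
  linear_combination (-F.det) * h1

lemma trace_transpose_mul_mul {n k : ℕ} (M : Matrix (Fin n) (Fin n) ℝ)
    (X : Matrix (Fin n) (Fin k) ℝ) :
    (Xᵀ * M * X).trace = ∑ c, (X.col c) ⬝ᵥ (M *ᵥ X.col c) := by
  rw [Matrix.trace]
  refine Finset.sum_congr rfl fun c _ => ?_
  rw [Matrix.diag_apply, Matrix.mul_assoc, Matrix.mul_apply]
  rfl

lemma trace_transpose_mul_mul_le {n k : ℕ} {M N : Matrix (Fin n) (Fin n) ℝ}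
    (h : ∀ x, x ⬝ᵥ (M *ᵥ x) ≤ x ⬝ᵥ (N *ᵥ x)) (X : Matrix (Fin n) (Fin k) ℝ) :
    (Xᵀ * M * X).trace ≤ (Xᵀ * N * X).trace := by
  rw [trace_transpose_mul_mul, trace_transpose_mul_mul]
  exact Finset.sum_le_sum fun c _ => h _

/-- Fan's inequality for the partial trace of a symmetric matrix with prescribed spectrum. -/
lemma trace_transpose_mul_conj_diagonal_mul_le {n k : ℕ} {D U : Matrix (Fin n) (Fin n) ℝ}
    (hD : D.IsDiag) (hU : U * Uᵀ = 1) {d : ℝ}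
    (hd : ∀ p : Fin n → ℝ, (∀ i, 0 ≤ p i) → (∀ i, p i ≤ 1) → ∑ i, p i = k →
      ∑ i, D i i * p i ≤ d)
    {X : Matrix (Fin n) (Fin k) ℝ} (hX : Xᵀ * X = 1) :
    (Xᵀ * (U * D * Uᵀ) * X).trace ≤ d := by
  obtain ⟨W, hW⟩ : ∃ W, W = Uᵀ * X := ⟨_, rfl⟩
  have hWW : Wᵀ * W = 1 := by
    calc Wᵀ * W = Xᵀ * (U * Uᵀ) * X := by
          rw [hW, Matrix.transpose_mul, Matrix.transpose_transpose]
          simp only [Matrix.mul_assoc]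
      _ = 1 := by rw [hU, Matrix.mul_one, hX]
  obtain ⟨N, hN⟩ : ∃ N, N = W * Wᵀ := ⟨_, rfl⟩
  have hNN : N * Nᵀ = N := by
    calc N * Nᵀ = W * (Wᵀ * W) * Wᵀ := by
          rw [hN, Matrix.transpose_mul, Matrix.transpose_transpose]
          simp only [Matrix.mul_assoc]
      _ = N := by rw [hWW, Matrix.mul_one, ← hN]
  have hdiag : ∀ i, N i i = ∑ j, N i j * N i j := fun i => by
    conv_lhs => rw [← hNN, Matrix.mul_apply]
    rfl
  have h1 : (Xᵀ * (U * D * Uᵀ) * X).trace = ∑ i, D i i * N i i := by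
    calc (Xᵀ * (U * D * Uᵀ) * X).trace = (Wᵀ * (D * W)).trace := by
          rw [hW, Matrix.transpose_mul, Matrix.transpose_transpose]
          simp only [Matrix.mul_assoc]
      _ = (D * N).trace := by rw [Matrix.trace_mul_comm, Matrix.mul_assoc, ← hN]
      _ = _ := by
        rw [← hD.diagonal_diag]
        simp [Matrix.trace, Matrix.diagonal_mul]
  rw [h1]
  refine hd (fun i => N i i) (fun i => ?_) (fun i => ?_) ?_
  · rw [hdiag]
    exact Finset.sum_nonneg fun j _ => mul_self_nonneg _
  · have h2 : N i i * N i i ≤ N i i := by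
      conv_rhs => rw [hdiag]
      exact Finset.single_le_sum (f := fun j => N i j * N i j)
        (fun j _ => mul_self_nonneg _) (Finset.mem_univ i)
    nlinarith
  · have h3 : N.trace = k := by
      rw [hN, Matrix.trace_mul_comm, hWW]
      simp
    exact h3

/-- One step of the estimate of principal minors: passing from `S` to `B * S * B + E`. -/
lemma det_transpose_mul_mul_le_exp_add {n k : ℕ} {S B E : Matrix (Fin n) (Fin n) ℝ}
    (hS : S.PosDef) (hB : Bᵀ = B) (hSE : (B * S * B + E).PosDef) {ε μ δ L : ℝ} (hε : 0 ≤ ε)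
    (hμ : 0 < μ) (hE : ∀ x, x ⬝ᵥ (E *ᵥ x) ≤ ε * (x ⬝ᵥ x))
    (hBSB : ∀ x, μ * (x ⬝ᵥ x) ≤ x ⬝ᵥ ((B * S * B) *ᵥ x))
    (hBB : ∀ X : Matrix (Fin n) (Fin k) ℝ, Xᵀ * X = 1 → (Xᵀ * (B * B) * X).trace ≤ k + δ)
    (hL : ∀ X : Matrix (Fin n) (Fin k) ℝ, Xᵀ * X = 1 → (Xᵀ * S * X).det ≤ Real.exp L)
    {X : Matrix (Fin n) (Fin k) ℝ} (hX : Xᵀ * X = 1) :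
    (Xᵀ * (B * S * B + E) * X).det ≤ Real.exp (L + δ + k * ε / μ) := by
  have hBinj : ∀ x, B *ᵥ x = 0 → x = 0 := by
    intro x hx
    have h := hBSB x
    rw [← Matrix.mulVec_mulVec, hx, Matrix.mulVec_zero, dotProduct_zero] at h
    have h0 : x ⬝ᵥ x ≤ 0 := by
      by_contra hne
      have := mul_pos hμ (not_le.mp hne)
      linarith
    exact dotProduct_self_eq_zero.mp (le_antisymm h0
      (Finset.sum_nonneg fun i _ => mul_self_nonneg _))
  have hXinj : ∀ x, X *ᵥ x = 0 → x = 0 := by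
    intro x hx
    rw [← Matrix.one_mulVec x, ← hX, ← Matrix.mulVec_mulVec, hx, Matrix.mulVec_zero]
  obtain ⟨Y, hY⟩ : ∃ Y, Y = B * X := ⟨_, rfl⟩
  have hYinj : Function.Injective Y.mulVec := by
    refine (injective_iff_map_eq_zero (Matrix.mulVecLin Y)).mpr fun x hx => ?_
    refine hXinj x (hBinj _ ?_)
    rwa [Matrix.mulVec_mulVec, ← hY]
  have hXinj' : Function.Injective X.mulVec :=
    (injective_iff_map_eq_zero (Matrix.mulVecLin X)).mpr hXinj
  have hYT : Yᵀ = Xᵀ * B := by rw [hY, Matrix.transpose_mul, hB]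
  have hG : (Yᵀ * Y).PosDef := by
    have := Matrix.PosDef.one.conjTranspose_mul_mul_same hYinj
    rwa [Matrix.mul_one] at this
  have hQ : (Yᵀ * S * Y).PosDef := hS.conjTranspose_mul_mul_same hYinj
  have hF : (Xᵀ * (B * S * B + E) * X).PosDef := hSE.conjTranspose_mul_mul_same hXinj'
  have hQeq : Yᵀ * S * Y = Xᵀ * (B * S * B) * X := by
    rw [hYT, hY]; simp only [Matrix.mul_assoc]
  have hQdet : (Yᵀ * S * Y).det ≤ Real.exp (L + δ) := by
    obtain ⟨K, hK, hKdet⟩ := hG.exists_congr_one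
    rw [hKdet, add_comm L, Real.exp_add]
    have h1 : Kᵀ * (Yᵀ * S * Y) * K = (Y * K)ᵀ * S * (Y * K) := by
      rw [Matrix.transpose_mul]; simp only [Matrix.mul_assoc]
    have h2 : (Y * K)ᵀ * (Y * K) = 1 := by
      rw [← hK, Matrix.transpose_mul]; simp only [Matrix.mul_assoc]
    have h3 : (Yᵀ * Y).trace ≤ k + δ := by
      have := hBB X hX
      rwa [hYT, hY, show Xᵀ * B * (B * X) = Xᵀ * (B * B) * X by simp only [Matrix.mul_assoc]]
    rw [h1]
    refine mul_le_mul (hG.posSemidef.det_le_exp_trace_sub.trans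
      (Real.exp_le_exp.mpr (by linarith))) (hL _ h2) ?_ (Real.exp_pos _).le
    exact (hS.posSemidef.conjTranspose_mul_mul_same (Y * K)).det_nonneg
  obtain ⟨K, hK, hKdet⟩ := hQ.exists_congr_one
  rw [hKdet, Real.exp_add]
  have hFK := hF.posSemidef.conjTranspose_mul_mul_same K
  refine mul_le_mul hQdet (hFK.det_le_exp_trace_sub.trans (Real.exp_le_exp.mpr ?_))
    hFK.det_nonneg (Real.exp_pos _).le
  obtain ⟨Z, hZ⟩ : ∃ Z, Z = X * K := ⟨_, rfl⟩
  have hZQ : Zᵀ * (B * S * B) * Z = 1 := by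
    rw [← hK, hQeq, hZ, Matrix.transpose_mul]; simp only [Matrix.mul_assoc]
  have hsplit : Kᴴ * (Xᵀ * (B * S * B + E) * X) * K = 1 + Zᵀ * E * Z := by
    rw [← hZQ, ← Matrix.add_mul, ← Matrix.mul_add, hZ, Matrix.transpose_mul]
    simp only [Matrix.mul_assoc]
    rfl
  have h1 := trace_transpose_mul_mul_le (M := E) (N := ε • (1 : Matrix (Fin n) (Fin n) ℝ))
    (fun x => by simpa [Matrix.smul_mulVec, dotProduct_smul] using hE x) Z
  have h2 := trace_transpose_mul_mul_le (M := μ • (1 : Matrix (Fin n) (Fin n) ℝ))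
    (N := B * S * B) (fun x => by simpa [Matrix.smul_mulVec, dotProduct_smul] using hBSB x) Z
  rw [hZQ] at h2
  simp only [Matrix.mul_smul, Matrix.smul_mul, Matrix.mul_one, Matrix.trace_smul, smul_eq_mul,
    Matrix.trace_one, Fintype.card_fin] at h1 h2
  rw [hsplit, Matrix.trace_add, Matrix.trace_one, Fintype.card_fin, add_sub_cancel_left]
  refine h1.trans ?_
  rw [mul_comm (k : ℝ), mul_div_assoc]
  exact mul_le_mul_of_nonneg_left ((le_div_iff₀' hμ).mpr h2) hε

lemma norm_sub_one_add_mul_mul_one_add_le {𝔸 : Type*} [NormedRing 𝔸] [NormedAlgebra ℝ 𝔸]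
    [CompleteSpace 𝔸] {A S : ℝ → 𝔸} {a M t h : ℝ} (hh : 0 ≤ h) (ha : 0 ≤ a) (hM : 0 ≤ M)
    (hA : ∀ s ∈ Set.Icc t (t + h), ‖A s‖ ≤ a) (hS : ∀ s ∈ Set.Icc t (t + h), ‖S s‖ ≤ M)
    (hAi : IntervalIntegrable A volume t (t + h)) (hSc : ContinuousOn S (Set.Icc t (t + h)))
    (hSA : ∀ s ∈ Set.Icc t (t + h), S s = S t + ∫ r in t..s, (A r * S r + S r * A r)) :
    ‖∫ s in t..(t + h), A s‖ ≤ a * h ∧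
    ‖S (t + h) - (1 + ∫ s in t..(t + h), A s) * S t * (1 + ∫ s in t..(t + h), A s)‖ ≤
      5 * a ^ 2 * M * h ^ 2 := by
  have hle : t ≤ t + h := by linarith
  have htm : t ∈ Set.Icc t (t + h) := ⟨le_rfl, hle⟩
  have hJ : ‖∫ s in t..(t + h), A s‖ ≤ a * h := by
    have := intervalIntegral.norm_integral_le_of_norm_le_const (f := A) (a := t) (b := t + h)
      (C := a) fun s hs => by
        rw [Set.uIoc_of_le hle] at hs
        exact hA s ⟨hs.1.le, hs.2⟩
    rwa [add_sub_cancel_left, abs_of_nonneg hh] at this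
  have hdiff : ∀ s ∈ Set.Icc t (t + h), ‖S s - S t‖ ≤ 2 * a * M * h := by
    intro s hs
    rw [hSA s hs, add_sub_cancel_left]
    have := intervalIntegral.norm_integral_le_of_norm_le_const
      (f := fun r => A r * S r + S r * A r) (a := t) (b := s) (C := 2 * a * M) fun r hr => by
        rw [Set.uIoc_of_le hs.1] at hr
        have hr' : r ∈ Set.Icc t (t + h) := ⟨hr.1.le, hr.2.trans hs.2⟩
        have h1 : ‖A r * S r‖ ≤ a * M := (norm_mul_le _ _).trans
          (mul_le_mul (hA r hr') (hS r hr') (norm_nonneg _) ha)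
        have h2 : ‖S r * A r‖ ≤ M * a := (norm_mul_le _ _).trans
          (mul_le_mul (hS r hr') (hA r hr') (norm_nonneg _) hM)
        exact (norm_add_le _ _).trans (by linarith)
    rw [abs_of_nonneg (by linarith [hs.1])] at this
    refine this.trans (mul_le_mul_of_nonneg_left (by linarith [hs.2]) (by positivity))
  refine ⟨hJ, ?_⟩
  have hSc' : ContinuousOn S (Set.uIcc t (t + h)) := by rwa [Set.uIcc_of_le hle]
  have hi1 : IntervalIntegrable (fun r => A r * S r + S r * A r) volume t (t + h) :=
    (hAi.mul_continuousOn hSc').add (hAi.continuousOn_mul hSc')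
  have hi2 : IntervalIntegrable (fun r => A r * S t + S t * A r) volume t (t + h) :=
    (hAi.mul_continuousOn continuousOn_const).add (hAi.continuousOn_mul continuousOn_const)
  have hint : ∫ r in t..(t + h), (A r * S t + S t * A r) =
      (∫ s in t..(t + h), A s) * S t + S t * ∫ s in t..(t + h), A s := by
    rw [intervalIntegral.integral_add (hAi.mul_continuousOn continuousOn_const)
      (hAi.continuousOn_mul continuousOn_const)]
    congr 1
    · exact ((ContinuousLinearMap.mul ℝ 𝔸).flip (S t)).intervalIntegral_comp_comm hAi
    · exact ((ContinuousLinearMap.mul ℝ 𝔸) (S t)).intervalIntegral_comp_comm hAi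
  have hkey : S (t + h) - (1 + ∫ s in t..(t + h), A s) * S t * (1 + ∫ s in t..(t + h), A s) =
      (∫ r in t..(t + h), ((A r * S r + S r * A r) - (A r * S t + S t * A r))) -
        (∫ s in t..(t + h), A s) * S t * (∫ s in t..(t + h), A s) := by
    rw [intervalIntegral.integral_sub hi1 hi2, hint, hSA (t + h) ⟨hle, le_rfl⟩]
    noncomm_ring
  rw [hkey]
  have h1 : ‖∫ r in t..(t + h), ((A r * S r + S r * A r) - (A r * S t + S t * A r))‖ ≤
      4 * a ^ 2 * M * h * h := by
    have := intervalIntegral.norm_integral_le_of_norm_le_const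
      (f := fun r => (A r * S r + S r * A r) - (A r * S t + S t * A r)) (a := t) (b := t + h)
      (C := 4 * a ^ 2 * M * h) fun r hr => by
        rw [Set.uIoc_of_le hle] at hr
        have hr' : r ∈ Set.Icc t (t + h) := ⟨hr.1.le, hr.2⟩
        rw [show (A r * S r + S r * A r) - (A r * S t + S t * A r) =
          A r * (S r - S t) + (S r - S t) * A r by noncomm_ring]
        have h1 : ‖A r * (S r - S t)‖ ≤ a * (2 * a * M * h) := (norm_mul_le _ _).trans
          (mul_le_mul (hA r hr') (hdiff r hr') (norm_nonneg _) ha)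
        have h2 : ‖(S r - S t) * A r‖ ≤ (2 * a * M * h) * a := (norm_mul_le _ _).trans
          (mul_le_mul (hdiff r hr') (hA r hr') (norm_nonneg _) (by positivity))
        exact (norm_add_le _ _).trans (by linarith)
    rwa [add_sub_cancel_left, abs_of_nonneg hh] at this
  have h2 : ‖(∫ s in t..(t + h), A s) * S t * (∫ s in t..(t + h), A s)‖ ≤
      (a * h) * M * (a * h) := by
    refine (norm_mul_le _ _).trans (mul_le_mul ?_ hJ (norm_nonneg _) (by positivity))
    exact (norm_mul_le _ _).trans (mul_le_mul hJ (hS t htm) (norm_nonneg _) (by positivity))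
  exact (norm_sub_le _ _).trans (by linarith)

section L2

open scoped Matrix.Norms.L2Operator

lemma dotProduct_mulVec_le_norm_mul {n : ℕ} (E : Matrix (Fin n) (Fin n) ℝ) (x : Fin n → ℝ) :
    x ⬝ᵥ (E *ᵥ x) ≤ ‖E‖ * (x ⬝ᵥ x) := by
  have h1 : x ⬝ᵥ (E *ᵥ x) = inner ℝ (WithLp.toLp 2 (E *ᵥ x)) (WithLp.toLp 2 x) := by
    rw [EuclideanSpace.inner_toLp_toLp]; simp
  have h2 : x ⬝ᵥ x = ‖WithLp.toLp 2 x‖ * ‖WithLp.toLp 2 x‖ := by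
    rw [← real_inner_self_eq_norm_mul_norm, EuclideanSpace.inner_toLp_toLp]; simp
  rw [h1, h2, ← mul_assoc]
  exact (real_inner_le_norm _ _).trans
    (mul_le_mul_of_nonneg_right (E.l2_opNorm_mulVec (WithLp.toLp 2 x)) (norm_nonneg _))

lemma norm_mul_mul_transpose_le {n : ℕ} (D : Matrix (Fin n) (Fin n) ℝ)
    {U : Matrix (Fin n) (Fin n) ℝ} (hU : U * Uᵀ = 1) :
    ‖U * D * Uᵀ‖ ≤ ‖D‖ * ‖(1 : Matrix (Fin n) (Fin n) ℝ)‖ := by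
  have h1 : ‖Uᵀ‖ = ‖U‖ := U.l2_opNorm_conjTranspose
  have h2 : ‖U‖ * ‖U‖ = ‖(1 : Matrix (Fin n) (Fin n) ℝ)‖ := by
    have := Matrix.l2_opNorm_conjTranspose_mul_self Uᵀ
    rw [h1] at this
    rw [← this, ← hU]
    rfl
  calc ‖U * D * Uᵀ‖ ≤ ‖U‖ * ‖D‖ * ‖Uᵀ‖ :=
        (norm_mul_le _ _).trans (mul_le_mul_of_nonneg_right (norm_mul_le _ _) (norm_nonneg _))
    _ = _ := by rw [h1, ← h2]; ring

lemma IntervalIntegrable.of_entries {n : ℕ} {F : ℝ → Matrix (Fin n) (Fin n) ℝ} {a b : ℝ}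
    (hF : ∀ i j, IntervalIntegrable (fun t => F t i j) volume a b) :
    IntervalIntegrable F volume a b := by
  have h : F = fun t => ∑ i, ∑ j, F t i j • Matrix.single i j (1 : ℝ) := by
    funext t
    conv_lhs => rw [Matrix.matrix_eq_sum_single (F t)]
    simp
  rw [h]
  exact ⟨integrable_finsetSum _ fun i _ => integrable_finsetSum _ fun j _ =>
      (hF i j).1.smul_const _,
    integrable_finsetSum _ fun i _ => integrable_finsetSum _ fun j _ => (hF i j).2.smul_const _⟩

lemma intervalIntegral_entry {n : ℕ} {F : ℝ → Matrix (Fin n) (Fin n) ℝ} {a b : ℝ}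
    (hF : IntervalIntegrable F volume a b) (i j : Fin n) :
    (∫ t in a..b, F t) i j = ∫ t in a..b, F t i j :=
  ((LinearMap.toContinuousLinearMap
    (Matrix.entryLinearMap ℝ ℝ i j)).intervalIntegral_comp_comm hF).symm

lemma trace_transpose_mul_integral_mul_le {n k : ℕ} {A : ℝ → Matrix (Fin n) (Fin n) ℝ} {t h d : ℝ}
    (hh : 0 ≤ h) (hA : IntervalIntegrable A volume t (t + h)) {X : Matrix (Fin n) (Fin k) ℝ}
    (hd : ∀ s ∈ Set.Icc t (t + h), (Xᵀ * A s * X).trace ≤ d) :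
    (Xᵀ * (∫ s in t..(t + h), A s) * X).trace ≤ h * d := by
  let l : Matrix (Fin n) (Fin n) ℝ →ₗ[ℝ] ℝ :=
    { toFun := fun M => (Xᵀ * M * X).trace
      map_add' := fun M N => by rw [Matrix.mul_add, Matrix.add_mul, Matrix.trace_add]
      map_smul' := fun c M => by simp }
  have h1 := (LinearMap.toContinuousLinearMap l).intervalIntegral_comp_comm hA
  have h2 : (Xᵀ * (∫ s in t..(t + h), A s) * X).trace =
      ∫ s in t..(t + h), (Xᵀ * A s * X).trace := h1.symm
  rw [h2]
  have hi : IntervalIntegrable (fun s => (Xᵀ * A s * X).trace) volume t (t + h) :=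
    ⟨(LinearMap.toContinuousLinearMap l).integrable_comp hA.1,
      (LinearMap.toContinuousLinearMap l).integrable_comp hA.2⟩
  have h3 := intervalIntegral.integral_mono_on (by linarith) hi
    (intervalIntegrable_const (c := d)) hd
  simpa using h3

lemma transpose_integral {n : ℕ} {A : ℝ → Matrix (Fin n) (Fin n) ℝ} {a b : ℝ} (hab : a ≤ b)
    (hA : IntervalIntegrable A volume a b) (hAT : ∀ s ∈ Set.Icc a b, (A s)ᵀ = A s) :
    (∫ s in a..b, A s)ᵀ = ∫ s in a..b, A s := by
  ext i j
  rw [Matrix.transpose_apply, intervalIntegral_entry hA, intervalIntegral_entry hA]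
  refine intervalIntegral.integral_congr fun s hs => ?_
  rw [Set.uIcc_of_le hab] at hs
  conv_rhs => rw [← hAT s hs]
  rfl

lemma IsReachable.exists_path {n : ℕ} {P₀ PT D : Matrix (Fin n) (Fin n) ℝ} {T : ℝ} (hT : 0 ≤ T)
    (h : IsReachable P₀ PT D T) :
    ∃ A S : ℝ → Matrix (Fin n) (Fin n) ℝ,
      (∀ t ∈ Set.Icc 0 T, ∃ U : Matrix (Fin n) (Fin n) ℝ, U * Uᵀ = 1 ∧ A t = U * D * Uᵀ) ∧
      IntervalIntegrable A volume 0 T ∧ ContinuousOn S (Set.Icc 0 T) ∧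
      (∀ t ∈ Set.Icc 0 T, (S t).PosDef) ∧ S 0 = P₀ ∧ S T = PT ∧
      ∀ t ∈ Set.Icc 0 T, ∀ s ∈ Set.Icc t T,
        S s = S t + ∫ r in t..s, (A r * S r + S r * A r) := by
  obtain ⟨U, S, hUm, hU, hS, hS0, hST, hint, hSU⟩ := h
  have hA : IntervalIntegrable (fun t => U t * D * (U t)ᵀ) volume 0 T := by
    refine .of_entries fun i j => ?_
    let l := LinearMap.toContinuousLinearMap (Matrix.entryLinearMap ℝ ℝ i j)
    refine (intervalIntegrable_const
      (c := ‖l‖ * (‖D‖ * ‖(1 : Matrix (Fin n) (Fin n) ℝ)‖))).mono_fun' ?_ ?_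
    · refine Measurable.aestronglyMeasurable ?_
      simp only [Matrix.mul_apply, Matrix.transpose_apply]
      fun_prop
    · refine (ae_restrict_mem measurableSet_uIoc).mono fun t ht => ?_
      rw [Set.uIoc_of_le hT] at ht
      exact (l.le_opNorm (U t * D * (U t)ᵀ)).trans (mul_le_mul_of_nonneg_left
        (norm_mul_mul_transpose_le D (hU t ⟨ht.1.le, ht.2⟩)) (norm_nonneg _))
  obtain ⟨Φ, hΦ⟩ : ∃ Φ : ℝ → Matrix (Fin n) (Fin n) ℝ,
    Φ = fun t => (U t * D * (U t)ᵀ) * S t + S t * (U t * D * (U t)ᵀ) := ⟨_, rfl⟩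
  have hΦi : IntervalIntegrable Φ volume 0 T := by
    rw [hΦ]
    exact .of_entries hint
  have hΦt : ∀ t ∈ Set.Icc 0 T, IntervalIntegrable Φ volume 0 t := fun t ht =>
    hΦi.mono_set (by
      rw [Set.uIcc_of_le hT, Set.uIcc_of_le ht.1]
      exact Set.Icc_subset_Icc_right ht.2)
  have hSΦ : ∀ t ∈ Set.Icc 0 T, S t = P₀ + ∫ r in (0 : ℝ)..t, Φ r := by
    intro t ht
    ext i j
    rw [Matrix.add_apply, intervalIntegral_entry (hΦt t ht), hSU t ht, hΦ]
  refine ⟨fun t => U t * D * (U t)ᵀ, S, fun t ht => ⟨U t, hU t ht, rfl⟩, hA, ?_, hS, hS0, hST, ?_⟩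
  · have hc := intervalIntegral.continuousOn_primitive_interval (μ := volume) (f := Φ) (a := 0)
      (b := T) (by rwa [Set.uIcc_of_le hT, ← intervalIntegrable_iff_integrableOn_Icc_of_le hT])
    rw [Set.uIcc_of_le hT] at hc
    exact (continuousOn_const.add hc).congr hSΦ
  · intro t ht s hs
    have hs' : s ∈ Set.Icc 0 T := ⟨ht.1.trans hs.1, hs.2⟩
    have h1 := intervalIntegral.integral_interval_sub_left (hΦt s hs') (hΦt t ht)
    rw [hSΦ s hs', hSΦ t ht]
    rw [hΦ] at h1 ⊢
    rw [← h1]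
    abel

lemma exists_pos_mul_dotProduct_le {n : ℕ} {S : ℝ → Matrix (Fin n) (Fin n) ℝ} {T : ℝ}
    (hSc : ContinuousOn S (Set.Icc 0 T)) (hS : ∀ t ∈ Set.Icc 0 T, (S t).PosDef) :
    ∃ m : ℝ, 0 < m ∧ ∀ t ∈ Set.Icc 0 T, ∀ x, m * (x ⬝ᵥ x) ≤ x ⬝ᵥ (S t *ᵥ x) := by
  have hcomp : IsCompact (Set.Icc (0 : ℝ) T ×ˢ Metric.sphere (0 : EuclideanSpace ℝ (Fin n)) 1) :=
    isCompact_Icc.prod (isCompact_sphere _ _)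
  have hcont : ContinuousOn (fun q : ℝ × EuclideanSpace ℝ (Fin n) =>
      q.2.ofLp ⬝ᵥ (S q.1 *ᵥ q.2.ofLp))
      (Set.Icc (0 : ℝ) T ×ˢ Metric.sphere (0 : EuclideanSpace ℝ (Fin n)) 1) := by
    simp only [dotProduct, Matrix.mulVec]
    refine continuousOn_finsetSum _ fun i _ => ContinuousOn.mul ?_ ?_
    · fun_prop
    · refine continuousOn_finsetSum _ fun j _ => ContinuousOn.mul ?_ ?_
      · have h1 : ContinuousOn (fun t => S t i j) (Set.Icc 0 T) :=
          (LinearMap.toContinuousLinearMap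
            (Matrix.entryLinearMap ℝ ℝ i j)).continuous.comp_continuousOn hSc
        exact h1.comp continuousOn_fst fun q hq => hq.1
      · fun_prop
  obtain ⟨m, hm, hmle⟩ := hcomp.exists_forall_le' hcont (a := 0) fun q hq => by
    have hne : q.2.ofLp ≠ 0 := by
      intro h0
      have h1 : q.2 = 0 := by ext i; exact congrFun h0 i
      have h2 := hq.2
      simp [h1] at h2
    simpa using (hS q.1 hq.1).dotProduct_mulVec_pos hne
  refine ⟨m, hm, fun t ht x => ?_⟩
  by_cases hx : x = 0
  · simp [hx]
  have hnx : (WithLp.toLp 2 x : EuclideanSpace ℝ (Fin n)) ≠ 0 := by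
    intro h0
    exact hx (congrArg WithLp.ofLp h0)
  have hxx : x ⬝ᵥ x = ‖WithLp.toLp 2 x‖ * ‖WithLp.toLp 2 x‖ := by
    rw [← real_inner_self_eq_norm_mul_norm, EuclideanSpace.inner_toLp_toLp]; simp
  have hpos : 0 < ‖WithLp.toLp 2 x‖ := norm_pos_iff.mpr hnx
  have h1 := hmle (t, ‖WithLp.toLp 2 x‖⁻¹ • WithLp.toLp 2 x) ⟨ht, by
    rw [mem_sphere_zero_iff_norm, norm_smul, norm_inv, norm_norm, inv_mul_cancel₀ hpos.ne']⟩
  simp only [WithLp.ofLp_smul, Matrix.mulVec_smul, smul_dotProduct, dotProduct_smul,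
    smul_eq_mul] at h1
  rw [hxx]
  have h2 : x ⬝ᵥ (S t *ᵥ x) = ‖WithLp.toLp 2 x‖ * ‖WithLp.toLp 2 x‖ *
      (‖WithLp.toLp 2 x‖⁻¹ * (‖WithLp.toLp 2 x‖⁻¹ * (x ⬝ᵥ (S t *ᵥ x)))) := by
    field_simp
  rw [h2, mul_comm m]
  exact mul_le_mul_of_nonneg_left h1 (by positivity)

/-- Along an isospectral path, compressions to `k`-dimensional subspaces have determinant growing
at most at the exponential rate `2 * d`, where `d` bounds the sums of `k` eigenvalues of `D`. -/
lemma IsReachable.det_transpose_mul_mul_le {n k : ℕ} {P₀ PT D : Matrix (Fin n) (Fin n) ℝ} {T : ℝ}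
    (hT : 0 < T) (hD : D.IsDiag) (h : IsReachable P₀ PT D T) {d L : ℝ}
    (hd : ∀ p : Fin n → ℝ, (∀ i, 0 ≤ p i) → (∀ i, p i ≤ 1) → ∑ i, p i = k →
      ∑ i, D i i * p i ≤ d)
    (hL : ∀ X : Matrix (Fin n) (Fin k) ℝ, Xᵀ * X = 1 → (Xᵀ * P₀ * X).det ≤ Real.exp L)
    {X : Matrix (Fin n) (Fin k) ℝ} (hX : Xᵀ * X = 1) :
    (Xᵀ * PT * X).det ≤ Real.exp (L + 2 * T * d) := by
  obtain ⟨A, S, hAU, hAi, hSc, hS, hS0, hST, hSA⟩ := h.exists_path hT.le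
  obtain ⟨m, hm, hmS⟩ := exists_pos_mul_dotProduct_le hSc hS
  obtain ⟨M, hM⟩ := isCompact_Icc.exists_bound_of_continuousOn hSc
  have hM0 : 0 ≤ M := (norm_nonneg _).trans (hM 0 ⟨le_rfl, hT.le⟩)
  obtain ⟨a, ha0, ha⟩ : ∃ a : ℝ, 0 ≤ a ∧ ∀ t ∈ Set.Icc 0 T, ‖A t‖ ≤ a := by
    refine ⟨‖D‖ * ‖(1 : Matrix (Fin n) (Fin n) ℝ)‖, by positivity, fun t ht => ?_⟩
    obtain ⟨U, hU, hAt⟩ := hAU t ht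
    rw [hAt]
    exact norm_mul_mul_transpose_le D hU
  obtain ⟨C, hC⟩ : ∃ C, C = k * a ^ 2 + k * (5 * a ^ 2 * M) / (m / 2) := ⟨_, rfl⟩
  have hstep : ∀ t h, 0 ≤ t → 0 ≤ h → t + h ≤ T → 5 * a ^ 2 * M * h ^ 2 ≤ m / 2 → ∀ L,
      (∀ X : Matrix (Fin n) (Fin k) ℝ, Xᵀ * X = 1 → (Xᵀ * S t * X).det ≤ Real.exp L) →
      ∀ X : Matrix (Fin n) (Fin k) ℝ, Xᵀ * X = 1 →
        (Xᵀ * S (t + h) * X).det ≤ Real.exp (L + (2 * h * d + C * h ^ 2)) := by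
    intro t h ht hh hth hsmall L hL X hX
    have hsub : Set.Icc t (t + h) ⊆ Set.Icc 0 T := Set.Icc_subset_Icc ht hth
    have hle : t ≤ t + h := by linarith
    have hAi' : IntervalIntegrable A volume t (t + h) := hAi.mono_set (by
      rwa [Set.uIcc_of_le hT.le, Set.uIcc_of_le hle])
    obtain ⟨hJ, hE⟩ := norm_sub_one_add_mul_mul_one_add_le hh ha0 hM0 (fun s hs => ha s (hsub hs))
      (fun s hs => hM s (hsub hs)) hAi' (hSc.mono hsub)
      fun s hs => hSA t (hsub ⟨le_rfl, hle⟩) s ⟨hs.1, hs.2.trans hth⟩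
    obtain ⟨J, hJdef⟩ : ∃ J, J = ∫ s in t..(t + h), A s := ⟨_, rfl⟩
    have hJT : Jᵀ = J := by
      rw [hJdef]
      refine transpose_integral hle hAi' fun s hs => ?_
      obtain ⟨U, hU, hAs⟩ := hAU s (hsub hs)
      rw [hAs, Matrix.transpose_mul, Matrix.transpose_mul, Matrix.transpose_transpose,
        hD.isSymm.eq, Matrix.mul_assoc]
    have hJd : ∀ X : Matrix (Fin n) (Fin k) ℝ, Xᵀ * X = 1 → (Xᵀ * J * X).trace ≤ h * d := by
      intro X hX
      rw [hJdef]
      refine trace_transpose_mul_integral_mul_le hh hAi' fun s hs => ?_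
      obtain ⟨U, hU, hAs⟩ := hAU s (hsub hs)
      rw [hAs]
      exact trace_transpose_mul_conj_diagonal_mul_le hD hU hd hX
    rw [← hJdef] at hJ hE
    obtain ⟨E, hEdef⟩ : ∃ E, E = S (t + h) - (1 + J) * S t * (1 + J) := ⟨_, rfl⟩
    rw [← hEdef] at hE
    have hSE : S (t + h) = (1 + J) * S t * (1 + J) + E := by rw [hEdef]; abel
    have hpd := hS (t + h) (hsub ⟨hle, le_rfl⟩)
    have hEx : ∀ x, x ⬝ᵥ (E *ᵥ x) ≤ 5 * a ^ 2 * M * h ^ 2 * (x ⬝ᵥ x) := fun x =>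
      (dotProduct_mulVec_le_norm_mul E x).trans (mul_le_mul_of_nonneg_right hE
        (Finset.sum_nonneg fun i _ => mul_self_nonneg _))
    have hJJ : ∀ x, x ⬝ᵥ ((J * J) *ᵥ x) ≤ x ⬝ᵥ (((a * h) ^ 2 • (1 : Matrix _ _ ℝ)) *ᵥ x) := by
      intro x
      rw [Matrix.smul_mulVec, Matrix.one_mulVec, dotProduct_smul, smul_eq_mul]
      refine (dotProduct_mulVec_le_norm_mul _ x).trans (mul_le_mul_of_nonneg_right ?_
        (Finset.sum_nonneg fun i _ => mul_self_nonneg _))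
      refine (norm_mul_le _ _).trans ?_
      rw [sq]
      exact mul_le_mul hJ hJ (norm_nonneg _) (by positivity)
    have key := det_transpose_mul_mul_le_exp_add (hS t (hsub ⟨le_rfl, hle⟩)) (B := 1 + J) (E := E)
      (by rw [Matrix.transpose_add, hJT, Matrix.transpose_one]) (by rwa [← hSE])
      (ε := 5 * a ^ 2 * M * h ^ 2) (μ := m / 2) (δ := 2 * h * d + k * (a * h) ^ 2) (by positivity)
      (by positivity) hEx (fun x => by
        have h1 := hmS (t + h) (hsub ⟨hle, le_rfl⟩) x
        have h2 := (hEx x).trans (mul_le_mul_of_nonneg_right hsmall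
          (Finset.sum_nonneg fun i _ => mul_self_nonneg (x i)))
        rw [hSE, Matrix.add_mulVec, dotProduct_add] at h1
        linarith) (fun X hX => by
        have h1 : Xᵀ * ((1 + J) * (1 + J)) * X =
            Xᵀ * X + (Xᵀ * J * X + Xᵀ * J * X) + Xᵀ * (J * J) * X := by
          simp only [Matrix.mul_add, Matrix.add_mul, Matrix.mul_one, Matrix.one_mul]
          abel
        have h2 := trace_transpose_mul_mul_le hJJ X
        rw [Matrix.mul_smul, Matrix.smul_mul, Matrix.mul_one, hX, Matrix.trace_smul,
          Matrix.trace_one, Fintype.card_fin, smul_eq_mul] at h2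
        have h3 := hJd X hX
        rw [h1, hX, Matrix.trace_add, Matrix.trace_add, Matrix.trace_add, Matrix.trace_one,
          Fintype.card_fin]
        linarith) hL hX
    rw [← hSE] at key
    refine key.trans (le_of_eq ?_)
    rw [hC]
    congr 1
    ring
  have hiter : ∀ N : ℕ, 0 < N → 5 * a ^ 2 * M * (T / N) ^ 2 ≤ m / 2 → ∀ j : ℕ, j ≤ N →
      ∀ X : Matrix (Fin n) (Fin k) ℝ, Xᵀ * X = 1 → (Xᵀ * S (j * (T / N)) * X).det ≤
        Real.exp (L + j * (2 * (T / N) * d + C * (T / N) ^ 2)) := by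
    intro N hN hsmall j
    have hN' : (0 : ℝ) < N := Nat.cast_pos.mpr hN
    induction j with
    | zero => simpa [hS0] using hL
    | succ j ih =>
      intro hj X hX
      have hj' : ((j : ℝ) + 1) ≤ N := by exact_mod_cast hj
      have h1 := hstep (j * (T / N)) (T / N) (by positivity) (by positivity) (by
        rw [← add_one_mul, mul_div_assoc', div_le_iff₀ hN', mul_comm T]
        exact mul_le_mul_of_nonneg_right hj' hT.le) hsmall _ (ih (Nat.le_of_succ_le hj)) X hX
      rw [← add_one_mul, add_assoc, ← add_one_mul] at h1
      exact_mod_cast h1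
  have hlim0 : Filter.Tendsto (fun N : ℕ => T / (N : ℝ)) Filter.atTop (nhds 0) :=
    tendsto_const_div_atTop_nhds_zero_nat T
  have hlim1 : Filter.Tendsto (fun N : ℕ => 5 * a ^ 2 * M * (T / (N : ℝ)) ^ 2) Filter.atTop
      (nhds 0) := by
    simpa using (hlim0.pow 2).const_mul (5 * a ^ 2 * M)
  have hlim2 : Filter.Tendsto (fun N : ℕ => Real.exp (L + 2 * T * d + C * T * (T / (N : ℝ))))
      Filter.atTop (nhds (Real.exp (L + 2 * T * d))) := by
    have := (hlim0.const_mul (C * T)).const_add (L + 2 * T * d)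
    rw [mul_zero, add_zero] at this
    exact (Real.continuous_exp.tendsto _).comp this
  refine ge_of_tendsto hlim2 ?_
  filter_upwards [hlim1.eventually_le_const (half_pos hm), Filter.eventually_gt_atTop 0]
    with N hsmall hN
  have hN' : (N : ℝ) ≠ 0 := Nat.cast_ne_zero.mpr hN.ne'
  have h1 := hiter N hN hsmall N le_rfl X hX
  rw [mul_div_cancel₀ T hN', hST] at h1
  refine h1.trans (le_of_eq ?_)
  congr 1
  field_simp
  ring

end L2

lemma IsReachable.symm {n : ℕ} {P₀ PT D : Matrix (Fin n) (Fin n) ℝ} {T : ℝ} (hT : 0 ≤ T)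
    (h : IsReachable P₀ PT D T) : IsReachable PT P₀ (-D) T := by
  obtain ⟨U, S, hUm, hU, hS, hS0, hST, hint, hSU⟩ := h
  have hmem : ∀ t ∈ Set.Icc 0 T, T - t ∈ Set.Icc 0 T := fun t ht =>
    ⟨by linarith [ht.2], by linarith [ht.1]⟩
  obtain ⟨Φ, hΦ⟩ : ∃ Φ : ℝ → Matrix (Fin n) (Fin n) ℝ,
    Φ = fun t => (U t * D * (U t)ᵀ) * S t + S t * (U t * D * (U t)ᵀ) := ⟨_, rfl⟩
  have hneg : ∀ t, (U t * (-D) * (U t)ᵀ) * S t + S t * (U t * (-D) * (U t)ᵀ) = -Φ t := by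
    intro t
    rw [hΦ]
    simp only [Matrix.mul_neg, Matrix.neg_mul, neg_add]
  have hΦi : ∀ i j, IntervalIntegrable (fun t => Φ t i j) volume 0 T := by
    rw [hΦ]
    exact hint
  refine ⟨fun t => U (T - t), fun t => S (T - t),
    fun i j => (hUm i j).comp (measurable_const.sub measurable_id), fun t ht => hU _ (hmem t ht),
    fun t ht => hS _ (hmem t ht), by simpa using hST, by simpa using hS0,
    fun i j => ?_, fun t ht i j => ?_⟩
  · simp only [hneg, Matrix.neg_apply]
    have h1 := ((hΦi i j).comp_sub_left T).symm.neg
    rwa [sub_self, sub_zero] at h1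
  · simp only [hneg, Matrix.neg_apply]
    rw [intervalIntegral.integral_neg,
      intervalIntegral.integral_comp_sub_left (fun s => Φ s i j) T, sub_zero]
    have h1 := hSU T ⟨hT, le_rfl⟩ i j
    have h2 := hSU (T - t) (hmem t ht) i j
    rw [hST] at h1
    have hΦt : IntervalIntegrable (fun t => Φ t i j) volume 0 (T - t) := (hΦi i j).mono_set (by
      rw [Set.uIcc_of_le hT, Set.uIcc_of_le (hmem t ht).1]
      exact Set.Icc_subset_Icc_right (hmem t ht).2)
    have h3 := intervalIntegral.integral_interval_sub_left (hΦi i j) hΦt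
    rw [hΦ] at h3 ⊢
    rw [h1, h2, ← h3]
    ring

lemma sum_mul_le_sum_sortDesc {n k : ℕ} (hk : k < n) (y p : Fin n → ℝ) (hp0 : ∀ i, 0 ≤ p i)
    (hp1 : ∀ i, p i ≤ 1) (hp : ∑ i, p i = k) :
    ∑ i, y i * p i ≤ ∑ i ∈ Finset.univ.filter (fun i : Fin n => (i : ℕ) < k), sortDesc y i := by
  rw [← Equiv.sum_comp (sortDescPerm y) fun i => y i * p i, Finset.sum_filter, ← sub_nonneg,
    ← Finset.sum_sub_distrib]
  have hcard : ∑ i : Fin n, (if (i : ℕ) < k then (1 : ℝ) else 0) = k := by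
    rw [Finset.sum_boole, Fin.card_filter_val_lt, min_eq_right hk.le]
  have hq : ∑ i, p (sortDescPerm y i) = k := by rw [Equiv.sum_comp, hp]
  have hzero : ∑ i : Fin n, sortDesc y ⟨k, hk⟩ *
      ((if (i : ℕ) < k then (1 : ℝ) else 0) - p (sortDescPerm y i)) = 0 := by
    rw [← Finset.mul_sum, Finset.sum_sub_distrib, hcard, hq, sub_self, mul_zero]
  rw [← hzero]
  refine Finset.sum_le_sum fun i _ => ?_
  have h0 := hp0 (sortDescPerm y i)
  have h1 := hp1 (sortDescPerm y i)
  rw [← sortDesc_apply y]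
  split_ifs with hi
  · have h2 : sortDesc y ⟨k, hk⟩ ≤ sortDesc y i := antitone_sortDesc y hi.le
    nlinarith
  · have h2 : sortDesc y i ≤ sortDesc y ⟨k, hk⟩ := antitone_sortDesc y (not_lt.mp hi)
    nlinarith

lemma exists_det_transpose_mul_mul_eq_prod {n k : ℕ} {P : Matrix (Fin n) (Fin n) ℝ}
    (hP : P.IsHermitian) {g : Fin k → Fin n} (hg : Function.Injective g) :
    ∃ X : Matrix (Fin n) (Fin k) ℝ, Xᵀ * X = 1 ∧
      (Xᵀ * P * X).det = ∏ i, hP.eigenvalues (g i) := by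
  obtain ⟨V, -, hV, hPV⟩ := exists_orthogonal_diagonalization hP
  refine ⟨V.submatrix id g, ?_, ?_⟩
  · rw [Matrix.transpose_submatrix, ← Matrix.submatrix_mul _ _ g id g Function.bijective_id, hV,
      Matrix.submatrix_one g hg]
  · have h1 : Vᵀ * P * V = diagonal hP.eigenvalues := by
      calc Vᵀ * P * V = (Vᵀ * V) * diagonal hP.eigenvalues * (Vᵀ * V) := by
            conv_lhs => rw [hPV]
            simp only [Matrix.mul_assoc]
        _ = _ := by rw [hV, Matrix.one_mul, Matrix.mul_one]
    have h2 : (V.submatrix id g)ᵀ * P * V.submatrix id g = (Vᵀ * P * V).submatrix g g := rfl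
    rw [h2, h1, Matrix.submatrix_diagonal _ g hg, Matrix.det_diagonal]
    rfl

lemma IsReachable.sum_log_eigenvalues_le {n k : ℕ} {T c : ℝ} (hT : 0 < T) (hc : 0 < c)
    {D PT : Matrix (Fin n) (Fin n) ℝ} (hD : D.IsDiag) (hPT : PT.PosDef)
    (h : IsReachable (c • (1 : Matrix (Fin n) (Fin n) ℝ)) PT D T) (hk : k < n) :
    ∑ i ∈ Finset.univ.filter (fun i : Fin n => (i : ℕ) < k),
      sortDesc (fun i => Real.log (hPT.1.eigenvalues i)) i ≤
    ∑ i ∈ Finset.univ.filter (fun i : Fin n => (i : ℕ) < k),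
      sortDesc (fun i => Real.log c + 2 * T * D i i) i := by
  set x : Fin n → ℝ := fun i => Real.log (hPT.1.eigenvalues i) with hx
  set y : Fin n → ℝ := fun i => Real.log c + 2 * T * D i i with hy
  set s := ∑ i ∈ Finset.univ.filter (fun i : Fin n => (i : ℕ) < k), sortDesc y i with hs
  obtain ⟨X, hX, hdet⟩ := exists_det_transpose_mul_mul_eq_prod hPT.1
    (g := fun i : Fin k => sortDescPerm x (Fin.castLE hk.le i))
    ((sortDescPerm x).injective.comp (Fin.castLE_injective hk.le))
  have h1 := h.det_transpose_mul_mul_le (k := k) (d := (s - k * Real.log c) / (2 * T))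
    (L := k * Real.log c) hT hD (fun p hp0 hp1 hp => by
      have h2 := sum_mul_le_sum_sortDesc hk y p hp0 hp1 hp
      have h3 : ∑ i, y i * p i = k * Real.log c + (∑ i, D i i * p i) * (2 * T) := by
        rw [← hp, Finset.sum_mul, Finset.sum_mul, ← Finset.sum_add_distrib]
        exact Finset.sum_congr rfl fun i _ => by simp only [hy]; ring
      rw [le_div_iff₀ (by positivity)]
      linarith) (fun X hX => by
      rw [Matrix.mul_smul, Matrix.smul_mul, Matrix.mul_one, hX, Matrix.det_smul, Matrix.det_one,
        Fintype.card_fin, Real.exp_nat_mul, Real.exp_log hc, mul_one]) hX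
  have h4 : ∏ i, hPT.1.eigenvalues (sortDescPerm x (Fin.castLE hk.le i)) =
      Real.exp (∑ i : Fin k, sortDesc x (Fin.castLE hk.le i)) := by
    rw [Real.exp_sum]
    exact Finset.prod_congr rfl fun i _ => (Real.exp_log (hPT.eigenvalues_pos _)).symm
  rw [hdet, h4, Real.exp_le_exp, mul_div_cancel₀ _ (by positivity : 2 * T ≠ 0)] at h1
  have h5 : ∑ i ∈ Finset.univ.filter (fun i : Fin n => (i : ℕ) < k), sortDesc x i =
      ∑ i : Fin k, sortDesc x (Fin.castLE hk.le i) := by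
    symm
    refine Finset.sum_bij (fun i _ => Fin.castLE hk.le i) (by simp)
      (fun i _ j _ hij => Fin.castLE_injective hk.le hij) (fun i hi => ?_) (fun _ _ => rfl)
    exact ⟨⟨i, (Finset.mem_filter.mp hi).2⟩, Finset.mem_univ _, rfl⟩
  rw [h5]
  linarith

lemma IsReachable.det_le {n : ℕ} {P₀ PT D : Matrix (Fin n) (Fin n) ℝ} {T : ℝ} (hT : 0 < T)
    (hD : D.IsDiag) (hP : 0 < P₀.det) (h : IsReachable P₀ PT D T) :
    PT.det ≤ P₀.det * Real.exp (2 * T * D.trace) := by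
  have h1 := h.det_transpose_mul_mul_le (k := n) (d := D.trace) (L := Real.log P₀.det) hT hD
    (fun p hp0 hp1 hp => by
      have h2 : ∀ i ∈ Finset.univ, p i = 1 :=
        (Finset.sum_eq_sum_iff_of_le fun i _ => hp1 i).mp (by simpa using hp)
      refine le_of_eq (Finset.sum_congr rfl fun i hi => ?_)
      rw [h2 i hi, mul_one, Matrix.diag_apply]) (fun X hX => by
      have h3 : Xᵀ.det * X.det = 1 := by rw [← Matrix.det_mul, hX, Matrix.det_one]
      rw [Real.exp_log hP, Matrix.det_mul, Matrix.det_mul, mul_right_comm, h3, one_mul])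
    (X := 1) (by simp)
  rwa [Matrix.transpose_one, Matrix.one_mul, Matrix.mul_one, Real.exp_add, Real.exp_log hP] at h1

lemma IsReachable.sum_log_eigenvalues_eq {n : ℕ} {T c : ℝ} (hT : 0 < T) (hc : 0 < c)
    {D PT : Matrix (Fin n) (Fin n) ℝ} (hD : D.IsDiag) (hPT : PT.PosDef)
    (h : IsReachable (c • (1 : Matrix (Fin n) (Fin n) ℝ)) PT D T) :
    ∑ i, Real.log (hPT.1.eigenvalues i) = ∑ i, (Real.log c + 2 * T * D i i) := by
  have hdc : (c • (1 : Matrix (Fin n) (Fin n) ℝ)).det = Real.exp (n * Real.log c) := by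
    rw [Matrix.det_smul, Matrix.det_one, Fintype.card_fin, Real.exp_nat_mul, Real.exp_log hc,
      mul_one]
  have hdP : PT.det = Real.exp (∑ i, Real.log (hPT.1.eigenvalues i)) := by
    rw [hPT.1.det_eq_prod_eigenvalues, Real.exp_sum]
    exact Finset.prod_congr rfl fun i _ => (Real.exp_log (hPT.eigenvalues_pos i)).symm
  have h1 := h.det_le hT hD (by rw [hdc]; exact Real.exp_pos _)
  have h2 := (h.symm hT.le).det_le hT hD.neg hPT.det_pos
  rw [hdc, hdP, ← Real.exp_add, Real.exp_le_exp] at h1 h2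
  rw [Matrix.trace_neg] at h2
  have h3 : ∑ i, (Real.log c + 2 * T * D i i) = n * Real.log c + 2 * T * D.trace := by
    rw [Finset.sum_add_distrib, ← Finset.mul_sum]
    simp [Matrix.trace]
  rw [h3]
  exact le_antisymm (by linarith) (by linarith)

/-- Theorem 5, characterization of the reachable set from `c·I`.
`R(cI, D, T) = { ΣT ∈ S⁺⁺ⁿ : log λ(ΣT) ≺ (log c)·𝟙 + 2T·λ(D) }`. -/
theorem isReachable_from_smul_one_iff
    {n : ℕ} (hn : 1 ≤ n) (T c : ℝ) (hT : 0 < T) (hc : 0 < c)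
    (D : Matrix (Fin n) (Fin n) ℝ) (hD : D.IsDiag)
    (PT : Matrix (Fin n) (Fin n) ℝ) (hPT : PT.PosDef) :
    IsReachable (c • (1 : Matrix (Fin n) (Fin n) ℝ)) PT D T ↔
      IsMajorizedBy (fun i => Real.log (hPT.1.eigenvalues i))
        (fun i => Real.log c + 2 * T * D i i) := by
  refine ⟨fun h => ⟨h.sum_log_eigenvalues_eq hT hc hD hPT,
    fun k hk => h.sum_log_eigenvalues_le hT hc hD hPT hk⟩,
    fun h => isReachable_of_mem_convexHull hT hc hD hPT h.mem_convexHull⟩
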